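/- Let a ≥ 2 and define P_n^{(a,2)} by P₀ = 1, P₁(x) = x, x·P_n = (1/a)P_{n−1} + ((a−1)/a)P_{n+1} (n ≥ 1). For |x| < 1/√(a−1), let μ_x be the measure on [−2√(a−1)/a, 2√(a−1)/a] with density (a/(2π)) · (1−x²)/(1+(a−1)x² − a z x) · √(4(a−1)/a² − z²)/(1−z²) with respect to Lebesgue measure dz. Then ∫ P_n^{(a,2)}(z) dμ_x(z) = x^n for all n ∈ ℕ₀. -/

import Mathlib

open MeasureTheory

/-- Cauchy's formula on the unit circle at a real point, folded to the upper half circle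
for functions that are real on the real axis. -/
lemma integral_re_upper_half_circle {f : ℂ → ℂ}
    (hf : DifferentiableOn ℂ f (Metric.closedBall 0 1))
    (hconj : ∀ w, f (starRingEnd ℂ w) = starRingEnd ℂ (f w)) {t : ℝ} (ht : |t| < 1) :
    ∫ θ in (0 : ℝ)..Real.pi, (circleMap 0 1 θ * f (circleMap 0 1 θ) / (circleMap 0 1 θ - t)).re =
      Real.pi * (f t).re := by
  set F : ℝ → ℂ := fun θ => circleMap 0 1 θ * f (circleMap 0 1 θ) / (circleMap 0 1 θ - t) with hF
  have hmem (θ : ℝ) : circleMap 0 1 θ ∈ Metric.closedBall (0 : ℂ) 1 :=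
    circleMap_mem_closedBall 0 zero_le_one θ
  have hne (θ : ℝ) : circleMap 0 1 θ - t ≠ 0 := by
    intro h
    have h1 : ‖circleMap 0 1 θ‖ = 1 := by simp [circleMap]
    rw [sub_eq_zero.mp h, Complex.norm_real, Real.norm_eq_abs] at h1
    linarith
  have hcont : Continuous F := by
    have hfc : Continuous fun θ : ℝ => f (circleMap 0 1 θ) :=
      hf.continuousOn.comp_continuous (continuous_circleMap 0 1) hmem
    exact ((continuous_circleMap 0 1).mul hfc).div
      ((continuous_circleMap 0 1).sub continuous_const) hne
  have hcauchy : ∫ θ in (0 : ℝ)..2 * Real.pi, F θ = 2 * Real.pi * f t := by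
    have hd : DiffContOnCl ℂ f (Metric.ball 0 1) := by
      apply DifferentiableOn.diffContOnCl
      rwa [closure_ball _ one_ne_zero]
    have h := hd.circleIntegral_sub_inv_smul (w := (t : ℂ)) (by simpa using ht)
    rw [circleIntegral] at h
    have h2 : ∀ θ : ℝ, deriv (circleMap 0 1) θ •
        ((circleMap 0 1 θ - (t : ℂ))⁻¹ • f (circleMap 0 1 θ)) = Complex.I * F θ := by
      intro θ
      simp only [deriv_circleMap, smul_eq_mul, hF]
      ring
    simp only [h2, intervalIntegral.integral_const_mul] at h
    rw [smul_eq_mul] at h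
    apply mul_left_cancel₀ Complex.I_ne_zero
    rw [h]; ring
  have hrefl (θ : ℝ) : F (2 * Real.pi - θ) = starRingEnd ℂ (F θ) := by
    have hc : circleMap 0 1 (2 * Real.pi - θ) = starRingEnd ℂ (circleMap 0 1 θ) := by
      simp only [circleMap, Complex.ofReal_one, one_mul, zero_add, ← Complex.exp_conj]
      have : ((2 * Real.pi - θ : ℝ) : ℂ) * Complex.I =
          starRingEnd ℂ (θ * Complex.I) + 2 * Real.pi * Complex.I := by
        simp; ring
      rw [this, Complex.exp_add, Complex.exp_two_pi_mul_I, mul_one]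
    simp only [hF, hc, hconj, map_div₀, map_mul, map_sub, Complex.conj_ofReal]
  have hre (u v : ℝ) : (∫ θ in u..v, F θ).re = ∫ θ in u..v, (F θ).re :=
    (Complex.reCLM.intervalIntegral_comp_comm (hcont.intervalIntegrable u v)).symm
  have hsplit := intervalIntegral.integral_add_adjacent_intervals
    (hcont.intervalIntegrable (μ := volume) 0 Real.pi)
    (hcont.intervalIntegrable Real.pi (2 * Real.pi))
  have hhalf : ∫ θ in Real.pi..2 * Real.pi, (F θ).re = ∫ θ in (0 : ℝ)..Real.pi, (F θ).re := by
    have h := intervalIntegral.integral_comp_sub_left (a := (0 : ℝ)) (b := Real.pi)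
      (fun θ => (F θ).re) (2 * Real.pi)
    simp only [hrefl, Complex.conj_re] at h
    rw [h]
    congr 1 <;> ring
  have := congrArg Complex.re (hsplit.trans hcauchy)
  rw [Complex.add_re, hre, hre, hhalf] at this
  have h3 : (2 * (Real.pi : ℂ) * f t).re = 2 * Real.pi * (f t).re := by
    simp
  rw [h3] at this
  linarith

/-- The function `(w² - 1) / (q - w²)`, with its singularity removed when `q = 1`. -/
lemma exists_regular_quotient {q : ℝ} (hq : 1 ≤ q) :
    ∃ g : ℂ → ℂ, DifferentiableOn ℂ g (Metric.closedBall 0 1) ∧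
      (∀ w, ‖w‖ ≤ 1 → (q - w ^ 2) * g w = w ^ 2 - 1) ∧
      ∀ w, g (starRingEnd ℂ w) = starRingEnd ℂ (g w) := by
  rcases hq.eq_or_lt with rfl | hq
  · exact ⟨fun _ => -1, differentiableOn_const _, fun w _ => by push_cast; ring, by simp⟩
  · have hne (w : ℂ) (hw : ‖w‖ ≤ 1) : (q : ℂ) - w ^ 2 ≠ 0 := by
      intro h
      have h1 : ‖(q : ℂ)‖ = ‖w‖ ^ 2 := by rw [sub_eq_zero.mp h, norm_pow]
      rw [Complex.norm_real, Real.norm_eq_abs, abs_of_pos (by linarith)] at h1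
      nlinarith [norm_nonneg w]
    refine ⟨fun w => (w ^ 2 - 1) / (q - w ^ 2), ?_, fun w hw => ?_, fun w => by simp⟩
    · exact DifferentiableOn.div (by fun_prop) (by fun_prop)
        fun w hw => hne w (by simpa using hw)
    · have := hne w hw
      field_simp

lemma one_sub_two_mul_cos_add_sq_pos {t : ℝ} (ht : |t| < 1) (θ : ℝ) :
    0 < 1 - 2 * t * Real.cos θ + t ^ 2 := by
  have h1 : t ^ 2 < 1 := (sq_lt_one_iff_abs_lt_one t).mpr ht
  nlinarith [sq_nonneg (t - Real.cos θ), Real.cos_sq_le_one θ, sq_nonneg (1 - t * Real.cos θ),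
    abs_le.mp (Real.abs_cos_le_one θ), abs_lt.mp ht, sq_nonneg (1 - t), sq_nonneg (1 + t)]

/-- The Poisson-type integral behind the spectral measure of the homogeneous tree, in angular
form. -/
lemma integral_sin_mul_div {q t : ℝ} (hq : 1 ≤ q) (ht : |t| < 1) (n : ℕ) :
    ∫ θ in Set.Ioo 0 Real.pi, Real.sin θ *
        (q * Real.sin ((n + 1) * θ) - Real.sin ((n - 1) * θ)) /
        ((1 - 2 * t * Real.cos θ + t ^ 2) * ((q + 1) ^ 2 - 4 * q * Real.cos θ ^ 2)) =
      Real.pi * t ^ n / (2 * (q - t ^ 2)) := by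
  obtain ⟨g, hg, hgq, hgc⟩ := exists_regular_quotient hq
  have ht2 : t ^ 2 < 1 := (sq_lt_one_iff_abs_lt_one t).mpr ht
  have hne (w : ℂ) (hw : ‖w‖ ≤ 1) : 1 - t * w ≠ 0 := by
    intro h
    have h1 : ‖(1 : ℂ)‖ = |t| * ‖w‖ := by
      rw [sub_eq_zero.mp h, norm_mul, Complex.norm_real, Real.norm_eq_abs]
    rw [norm_one] at h1
    nlinarith [norm_nonneg w, abs_nonneg t]
  have key := integral_re_upper_half_circle (f := fun w => w ^ n * g w / (1 - t * w))
    (DifferentiableOn.div (by fun_prop) (by fun_prop)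
      fun w hw => hne w (by simpa using hw))
    (fun w => by simp [hgc]) ht
  have hval : ((t : ℂ) ^ n * g t / (1 - t * t)).re = - t ^ n / (q - t ^ 2) := by
    have h0 := hgq t (by simpa using ht.le)
    have h1 : (q : ℂ) - t ^ 2 ≠ 0 := by
      norm_cast; nlinarith
    have h2 : (1 : ℂ) - t * t ≠ 0 := by
      norm_cast; nlinarith
    have h3 : (t : ℂ) ^ n * g t / (1 - t * t) = ((- t ^ n / (q - t ^ 2) : ℝ) : ℂ) := by
      push_cast
      rw [div_eq_div_iff h2 h1]
      linear_combination (t : ℂ) ^ n * h0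
    rw [h3, Complex.ofReal_re]
  rw [hval, intervalIntegral.integral_of_le Real.pi_pos.le, integral_Ioc_eq_integral_Ioo] at key
  have hpt : ∀ θ ∈ Set.Ioo 0 Real.pi, Real.sin θ *
        (q * Real.sin ((n + 1) * θ) - Real.sin ((n - 1) * θ)) /
        ((1 - 2 * t * Real.cos θ + t ^ 2) * ((q + 1) ^ 2 - 4 * q * Real.cos θ ^ 2)) =
      (-1 / 2) * (circleMap 0 1 θ * (circleMap 0 1 θ ^ n * g (circleMap 0 1 θ) /
        (1 - t * circleMap 0 1 θ)) / (circleMap 0 1 θ - t)).re := by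
    intro θ hθ
    have hs : 0 < Real.sin θ := Real.sin_pos_of_pos_of_lt_pi hθ.1 hθ.2
    have hD := one_sub_two_mul_cos_add_sq_pos ht θ
    have hE : 0 < (q + 1) ^ 2 - 4 * q * Real.cos θ ^ 2 := by
      nlinarith [Real.sin_sq_add_cos_sq θ, sq_nonneg (q - 1), mul_pos hs hs]
    have hw1 : ‖circleMap 0 1 θ‖ = 1 := by simp [circleMap]
    have hwn : circleMap 0 1 θ ^ n =
        Complex.cos (n * θ) + Complex.sin (n * θ) * Complex.I := by
      simp only [circleMap, Complex.ofReal_one, one_mul, zero_add, ← Complex.exp_nat_mul]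
      rw [← mul_assoc, Complex.exp_mul_I]
    have hw : circleMap 0 1 θ = Complex.cos θ + Complex.sin θ * Complex.I := by
      simp [circleMap, Complex.exp_mul_I]
    have hgw := hgq _ hw1.le
    have h1 := hne _ hw1.le
    have h2 : circleMap 0 1 θ - t ≠ 0 := by
      intro h
      rw [sub_eq_zero.mp h, Complex.norm_real, Real.norm_eq_abs] at hw1
      linarith
    rw [hwn]
    generalize circleMap 0 1 θ = w at *
    have hcs := Complex.sin_sq_add_cos_sq θ
    have hI := Complex.I_sq
    set c := Complex.cos θ with hc
    set s := Complex.sin θ with hsdef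
    obtain ⟨v, hv⟩ : ∃ v, v = c - s * Complex.I := ⟨_, rfl⟩
    have hwv : w * v = 1 := by
      rw [hw, hv]; linear_combination hcs - s ^ 2 * hI
    have hwc : c = (w + v) / 2 := by rw [hw, hv]; ring
    have hws : s * Complex.I = (w - v) / 2 := by rw [hw, hv]; ring
    have hDc : (1 - 2 * t * c + t ^ 2 : ℂ) ≠ 0 := by
      rw [hc]; exact_mod_cast hD.ne'
    have hEc : ((q + 1) ^ 2 - 4 * q * c ^ 2 : ℂ) ≠ 0 := by
      rw [hc]; exact_mod_cast hE.ne'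
    have hgval : g w = 2 * s * Complex.I * (q * w - v) / ((q + 1) ^ 2 - 4 * q * c ^ 2) := by
      have hfac : ((q + 1) ^ 2 - 4 * q * c ^ 2 : ℂ) = (q - w ^ 2) * (q - v ^ 2) := by
        rw [hwc]; linear_combination (-(1 + w * v + 2 * q)) * hwv
      rw [eq_div_iff hEc, hfac]
      linear_combination (q - v ^ 2) * hgw - 2 * (q * w - v) * hws + (q - w * v) * hwv
    have hval : w * ((Complex.cos (n * θ) + Complex.sin (n * θ) * Complex.I) * g w /
        (1 - t * w)) / (w - t) =
        (Complex.cos (n * θ) + Complex.sin (n * θ) * Complex.I) * g w /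
          (1 - 2 * t * c + t ^ 2) := by
      have hfac : (1 - 2 * t * c + t ^ 2 : ℂ) * w = (1 - t * w) * (w - t) := by
        rw [hwc]; linear_combination (-t : ℂ) * hwv
      rw [mul_div_assoc', div_div, ← hfac]
      have hw0 : w ≠ 0 := left_ne_zero_of_mul_eq_one hwv
      field_simp
    rw [hval, hgval, hw, hv]
    have hfin : (Complex.cos (n * θ) + Complex.sin (n * θ) * Complex.I) *
        (2 * s * Complex.I * (q * (c + s * Complex.I) - (c - s * Complex.I)) /
          ((q + 1) ^ 2 - 4 * q * c ^ 2)) / (1 - 2 * t * c + t ^ 2) =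
        ((-2 * (Real.sin θ *
        (q * Real.sin ((n + 1) * θ) - Real.sin ((n - 1) * θ)) /
        ((1 - 2 * t * Real.cos θ + t ^ 2) * ((q + 1) ^ 2 - 4 * q * Real.cos θ ^ 2))) : ℝ) : ℂ)
        + ((2 * (Real.sin θ *
        (q * Real.cos ((n + 1) * θ) - Real.cos ((n - 1) * θ)) /
        ((1 - 2 * t * Real.cos θ + t ^ 2) * ((q + 1) ^ 2 - 4 * q * Real.cos θ ^ 2))) : ℝ) : ℂ)
          * Complex.I := by
      have e1 : ((n : ℝ) + 1) * θ = n * θ + θ := by ring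
      have e2 : ((n : ℝ) - 1) * θ = n * θ - θ := by ring
      rw [e1, e2, Real.sin_add, Real.sin_sub, Real.cos_add, Real.cos_sub]
      push_cast
      rw [← hc, ← hsdef]
      generalize (1 - 2 * t * c + t ^ 2 : ℂ) = D
      generalize ((q + 1) ^ 2 - 4 * q * c ^ 2 : ℂ) = E
      linear_combination 2 * s / E / D *
        ((q - 1) * c * Complex.sin (n * θ) + (q + 1) * s * Complex.cos (n * θ) +
        (q + 1) * s * Complex.sin (n * θ) * Complex.I) * hI
    rw [hfin, Complex.add_re, Complex.ofReal_re, Complex.re_ofReal_mul, Complex.I_re]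
    ring
  rw [setIntegral_congr_fun measurableSet_Ioo hpt, integral_const_mul, key]
  have : q - t ^ 2 ≠ 0 := by nlinarith
  field_simp

/-- The polynomials of the homogeneous tree in the angular variable. -/
lemma tree_polynomial_eq_sin {a s : ℝ} (ha : 0 < a) (hs : s ^ 2 = a - 1) (hs0 : 0 < s)
    {P : ℕ → ℝ → ℝ} (hP0 : ∀ x : ℝ, P 0 x = 1) (hP1 : ∀ x : ℝ, P 1 x = x)
    (hrec : ∀ n : ℕ, 1 ≤ n → ∀ x : ℝ,
      x * P n x = (1 / a) * P (n - 1) x + ((a - 1) / a) * P (n + 1) x) (θ : ℝ) (n : ℕ) :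
    a * s ^ n * Real.sin θ * P n (2 * s / a * Real.cos θ) =
      s ^ 2 * Real.sin ((n + 1) * θ) - Real.sin ((n - 1) * θ) := by
  induction n using Nat.twoStepInduction with
  | zero =>
    simp only [hP0, Nat.cast_zero, zero_add, zero_sub, one_mul, neg_mul, Real.sin_neg]
    linear_combination (-Real.sin θ) * hs
  | one =>
    have e : ((1 : ℕ) + 1 : ℝ) * θ = 2 * θ := by push_cast; ring
    rw [hP1, e, Real.sin_two_mul]
    simp
    field_simp
  | more n h0 h1 =>
    have hr := hrec (n + 1) (by omega) (2 * s / a * Real.cos θ)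
    have hy : a * (2 * s / a * Real.cos θ) = 2 * s * Real.cos θ := by field_simp
    generalize 2 * s / a * Real.cos θ = y at *
    rw [← hs, Nat.add_sub_cancel] at hr
    field_simp at hr
    have e1 : ((n : ℝ) - 1) * θ = (n + 1) * θ - (θ + θ) := by ring
    have e2 : (((n + 1 : ℕ) : ℝ) + 1) * θ = (n + 1) * θ + θ := by push_cast; ring
    have e3 : (((n + 1 : ℕ) : ℝ) - 1) * θ = (n + 1) * θ - θ := by push_cast; ring
    have e4 : (((n + 2 : ℕ) : ℝ) + 1) * θ = (n + 1) * θ + (θ + θ) := by push_cast; ring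
    have e5 : (((n + 2 : ℕ) : ℝ) - 1) * θ = (n + 1) * θ := by push_cast; ring
    rw [e1] at h0
    rw [e2, e3] at h1
    rw [e4, e5]
    simp only [Real.sin_add, Real.sin_sub, Real.cos_add] at h0 h1 ⊢
    have hcs := Real.sin_sq_add_cos_sq θ
    set S := Real.sin (((n : ℝ) + 1) * θ)
    set c := Real.cos θ
    set σ := Real.sin θ
    linear_combination 2 * c * h1 - h0 - a * s ^ n * σ * hr +
      a * s ^ n * σ * P (n + 1) y * hy + (s ^ 2 - 1) * S * hcs

theorem tree_spectral_measure_of_gibbs (a : ℕ) (ha : 2 ≤ a)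
    (P : ℕ → ℝ → ℝ)
    (hP0 : ∀ x : ℝ, P 0 x = 1)
    (hP1 : ∀ x : ℝ, P 1 x = x)
    (hrec : ∀ n : ℕ, 1 ≤ n → ∀ x : ℝ,
      x * P n x = (1 / (a : ℝ)) * P (n - 1) x + (((a : ℝ) - 1) / a) * P (n + 1) x)
    (x : ℝ) (hx : |x| < 1 / Real.sqrt ((a : ℝ) - 1)) (n : ℕ) :
    ∫ z in Set.Icc (-(2 * Real.sqrt ((a : ℝ) - 1) / a)) (2 * Real.sqrt ((a : ℝ) - 1) / a),
        P n z * (((a : ℝ) / (2 * Real.pi)) * (1 - x ^ 2) /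
          (1 + ((a : ℝ) - 1) * x ^ 2 - a * z * x) *
          (Real.sqrt (4 * ((a : ℝ) - 1) / a ^ 2 - z ^ 2) / (1 - z ^ 2))) =
      x ^ n := by
  have ha' : (2 : ℝ) ≤ a := by exact_mod_cast ha
  generalize (a : ℝ) = b at *
  have hs : Real.sqrt (b - 1) ^ 2 = b - 1 := Real.sq_sqrt (by linarith)
  have hs0 : 0 < Real.sqrt (b - 1) := Real.sqrt_pos.mpr (by linarith)
  generalize Real.sqrt (b - 1) = s at *
  have hb0 : 0 < b := by linarith
  set r := 2 * s / b with hr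
  have hr0 : 0 < r := by positivity
  have ht : |s * x| < 1 := by
    rw [abs_mul, abs_of_pos hs0]
    rw [lt_div_iff₀ hs0] at hx
    linarith
  have himg : (fun θ => r * Real.cos θ) '' Set.Ioo 0 Real.pi = Set.Ioo (-r) r := by
    ext z
    constructor
    · rintro ⟨θ, hθ, rfl⟩
      have h1 : Real.cos θ < 1 := by
        simpa using Real.cos_lt_cos_of_nonneg_of_le_pi le_rfl hθ.2.le hθ.1
      have h2 : -1 < Real.cos θ := by
        simpa using Real.cos_lt_cos_of_nonneg_of_le_pi hθ.1.le le_rfl hθ.2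
      exact ⟨by nlinarith, by nlinarith⟩
    · rintro ⟨h1, h2⟩
      have h3 : -1 < z / r := by rw [lt_div_iff₀ hr0]; linarith
      have h4 : z / r < 1 := by rw [div_lt_iff₀ hr0]; linarith
      refine ⟨Real.arccos (z / r), ⟨Real.arccos_pos.mpr h4, Real.arccos_lt_pi.mpr h3⟩, ?_⟩
      simp only [Real.cos_arccos h3.le h4.le]
      field_simp
  have hinj : Set.InjOn (fun θ => r * Real.cos θ) (Set.Ioo 0 Real.pi) := by
    intro u hu v hv h
    exact Real.injOn_cos ⟨hu.1.le, hu.2.le⟩ ⟨hv.1.le, hv.2.le⟩ (mul_left_cancel₀ hr0.ne' h)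
  rw [integral_Icc_eq_integral_Ioo, ← himg,
    integral_image_eq_integral_abs_deriv_smul measurableSet_Ioo
      (fun θ _ => ((Real.hasDerivAt_cos θ).const_mul r).hasDerivWithinAt) hinj]
  have hpt : ∀ θ ∈ Set.Ioo 0 Real.pi, |r * -Real.sin θ| • (P n (r * Real.cos θ) *
        (b / (2 * Real.pi) * (1 - x ^ 2) / (1 + (b - 1) * x ^ 2 - b * (r * Real.cos θ) * x) *
        (Real.sqrt (4 * (b - 1) / b ^ 2 - (r * Real.cos θ) ^ 2) /
          (1 - (r * Real.cos θ) ^ 2)))) =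
      2 * s ^ 2 * (1 - x ^ 2) / (Real.pi * s ^ n) * (Real.sin θ *
        (s ^ 2 * Real.sin ((n + 1) * θ) - Real.sin ((n - 1) * θ)) /
        ((1 - 2 * (s * x) * Real.cos θ + (s * x) ^ 2) *
          ((s ^ 2 + 1) ^ 2 - 4 * s ^ 2 * Real.cos θ ^ 2))) := by
    intro θ hθ
    have hsin : 0 < Real.sin θ := Real.sin_pos_of_pos_of_lt_pi hθ.1 hθ.2
    have hcs := Real.sin_sq_add_cos_sq θ
    have hsq : Real.sqrt (4 * (b - 1) / b ^ 2 - (r * Real.cos θ) ^ 2) = r * Real.sin θ := by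
      rw [← Real.sqrt_sq (mul_pos hr0 hsin).le]
      congr 1
      rw [← hs, hr]
      field_simp
      linear_combination -4 * hcs
    have hD := one_sub_two_mul_cos_add_sq_pos ht θ
    have hE : 0 < (s ^ 2 + 1) ^ 2 - 4 * s ^ 2 * Real.cos θ ^ 2 := by
      nlinarith [sq_nonneg (s ^ 2 - 1), mul_pos (mul_pos hs0 hsin) (mul_pos hs0 hsin)]
    have h1 : 1 + (b - 1) * x ^ 2 - b * (r * Real.cos θ) * x =
        1 - 2 * (s * x) * Real.cos θ + (s * x) ^ 2 := by
      rw [← hs, hr]; field_simp; ring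
    have h2 : 1 - (r * Real.cos θ) ^ 2 =
        ((s ^ 2 + 1) ^ 2 - 4 * s ^ 2 * Real.cos θ ^ 2) / b ^ 2 := by
      rw [hs, hr]; field_simp; linear_combination (-4 * Real.cos θ ^ 2) * hs
    rw [← tree_polynomial_eq_sin hb0 hs hs0 hP0 hP1 hrec θ n, hsq, h1, h2, mul_neg, abs_neg,
      abs_of_pos (mul_pos hr0 hsin), ← hr, smul_eq_mul]
    have hD' := hD.ne'
    have hE' := hE.ne'
    set D := 1 - 2 * (s * x) * Real.cos θ + (s * x) ^ 2
    set E := (s ^ 2 + 1) ^ 2 - 4 * s ^ 2 * Real.cos θ ^ 2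
    generalize P n (r * Real.cos θ) = p
    have hpi := Real.pi_pos.ne'
    rw [hr]
    field_simp
  rw [setIntegral_congr_fun measurableSet_Ioo hpt, integral_const_mul,
    integral_sin_mul_div (by linarith) ht n]
  have hx2 : s ^ 2 - (s * x) ^ 2 ≠ 0 := by
    have := (sq_lt_one_iff_abs_lt_one _).mpr ht
    nlinarith
  have hpi := Real.pi_pos.ne'
  rw [mul_pow s x n]
  have hx3 : 1 - x ^ 2 ≠ 0 := fun h => hx2 (by linear_combination s ^ 2 * h)
  field_simp
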